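/- arXiv:2603.07844 — 4 statements merged into one kernel-verified Lean document; each statement's English description precedes it below -/
import Mathlib

section
/- In a deterministic planning problem, the optimal cost-to-go satisfies the Bellman equation: G* x = 0 for every x ∈ G, and for every x ∉ G, G* x = ⨅ (u : U), ((ℓ x u : ℝ≥0∞) + G* (f x u)). -/
open scoped NNReal ENNReal

variable {X U : Type*}

/-- Trajectory of an action sequence `a` from state `x` under transition function `f`. -/
def traj (f : X → U → X) (x : X) (a : ℕ → U) : ℕ → X
  | 0 => x
  | k + 1 => f (traj f x a k) (a k)

/-- The `K`-stage cost of the action sequence `a` from `x`. -/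
def cost (f : X → U → X) (ℓ : X → U → ℝ≥0) (x : X) (a : ℕ → U) (K : ℕ) : ℝ≥0 :=
  ∑ k ∈ Finset.range K, ℓ (traj f x a k) (a k)

/-- The optimal cost-to-go: infimum of cost over all goal-reaching plans (⊤ if none). -/
noncomputable def Gstar (f : X → U → X) (ℓ : X → U → ℝ≥0) (G : Set X) (x : X) : ℝ≥0∞ :=
  ⨅ (K : ℕ) (a : ℕ → U) (_ : traj f x a K ∈ G), (cost f ℓ x a K : ℝ≥0∞)

theorem traj_succ_left (f : X → U → X) (x : X) (a : ℕ → U) (k : ℕ) :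
    traj f x a (k + 1) = traj f (f x (a 0)) (fun i => a (i + 1)) k := by
  induction k with
  | zero => rfl
  | succ k ih => rw [traj, ih]; rfl

theorem cost_succ_left (f : X → U → X) (ℓ : X → U → ℝ≥0) (x : X) (a : ℕ → U) (K : ℕ) :
    cost f ℓ x a (K + 1) =
      ℓ x (a 0) + cost f ℓ (f x (a 0)) (fun i => a (i + 1)) K := by
  simp only [cost, Finset.sum_range_succ', traj_succ_left]
  exact add_comm _ _

theorem Gstar_le_cost {f : X → U → X} {ℓ : X → U → ℝ≥0} {G : Set X} {x : X} {a : ℕ → U} {K : ℕ}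
    (h : traj f x a K ∈ G) : Gstar f ℓ G x ≤ cost f ℓ x a K :=
  iInf_le_of_le K (iInf_le_of_le a (iInf_le_of_le h le_rfl))

/-- Bellman equation for the optimal cost-to-go in a deterministic planning problem. -/
theorem Gstar_bellman [Fintype X] [Fintype U] [Nonempty U]
    (f : X → U → X) (ℓ : X → U → ℝ≥0) (G : Set X) :
    (∀ x ∈ G, Gstar f ℓ G x = 0) ∧
    (∀ x ∉ G, Gstar f ℓ G x =
      ⨅ (u : U), ((ℓ x u : ℝ≥0∞) + Gstar f ℓ G (f x u))) := by
  refine ⟨fun x hx => ?_, fun x hx => le_antisymm (le_iInf fun u => ?_) ?_⟩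
  · obtain ⟨a⟩ : Nonempty (ℕ → U) := inferInstance
    have h : traj f x a 0 ∈ G := hx
    simpa [cost] using Gstar_le_cost (ℓ := ℓ) h
  · rw [Gstar.eq_def f ℓ G (f x u)]
    simp only [ENNReal.add_iInf]
    refine le_iInf fun K => le_iInf fun a => le_iInf fun h => ?_
    let b : ℕ → U := fun i => Nat.casesOn i u a
    have hb : traj f x b (K + 1) ∈ G := by rwa [traj_succ_left]
    refine (Gstar_le_cost (ℓ := ℓ) hb).trans_eq ?_
    rw [cost_succ_left, ENNReal.coe_add]
    rfl
  · refine le_iInf fun K => le_iInf fun a => le_iInf fun h => ?_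
    cases K with
    | zero => exact absurd h hx
    | succ K =>
      rw [traj_succ_left] at h
      rw [cost_succ_left, ENNReal.coe_add]
      exact iInf_le_of_le (a 0) (add_le_add_right (Gstar_le_cost h) _)
end

section
/- In a deterministic planning problem, for every state x, every K : ℕ, and every action sequence a : ℕ → U with traj x a K ∈ G, there exist K' < Fintype.card X and an action sequence a' : ℕ → U such that traj x a' K' ∈ G and cost x a' K' ≤ cost x a K. -/
open scoped NNReal ENNReal

variable {X U : Type*}

/-- The action sequence `a` with the block of `d` actions starting at time `i` removed. -/
def skipBlock (a : ℕ → U) (i d k : ℕ) : U :=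
  if k < i then a k else a (k + d)

theorem traj_skipBlock_of_le (f : X → U → X) (x : X) (a : ℕ → U) (i d : ℕ) {k : ℕ}
    (hk : k ≤ i) : traj f x (skipBlock a i d) k = traj f x a k := by
  induction k with
  | zero => rfl
  | succ k ih => simp [traj, ih (by omega), skipBlock, show k < i by omega]

theorem traj_skipBlock_add (f : X → U → X) (x : X) (a : ℕ → U) {i d : ℕ}
    (hloop : traj f x a (i + d) = traj f x a i) (k : ℕ) :
    traj f x (skipBlock a i d) (i + k) = traj f x a (i + k + d) := by
  induction k with
  | zero => simp [traj_skipBlock_of_le, hloop]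
  | succ k ih =>
    rw [show i + (k + 1) + d = i + k + d + 1 by omega, ← Nat.add_assoc, traj, traj, ih]
    simp [skipBlock]

theorem cost_add (f : X → U → X) (ℓ : X → U → ℝ≥0) (x : X) (a : ℕ → U) (m n : ℕ) :
    cost f ℓ x a (m + n) =
      cost f ℓ x a m + ∑ k ∈ Finset.range n, ℓ (traj f x a (m + k)) (a (m + k)) :=
  Finset.sum_range_add _ _ _

theorem cost_skipBlock_le (f : X → U → X) (ℓ : X → U → ℝ≥0) (x : X) (a : ℕ → U) {i d : ℕ}
    (hloop : traj f x a (i + d) = traj f x a i) (m : ℕ) :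
    cost f ℓ x (skipBlock a i d) (i + m) ≤ cost f ℓ x a (i + d + m) := by
  have hprefix : cost f ℓ x (skipBlock a i d) i = cost f ℓ x a i := by
    refine Finset.sum_congr rfl fun k hk => ?_
    have hk := Finset.mem_range.1 hk
    simp [traj_skipBlock_of_le f x a i d hk.le, skipBlock, hk]
  rw [cost_add, cost_add f ℓ x a (i + d), hprefix]
  refine add_le_add ?_ (Finset.sum_le_sum fun k _ => ?_)
  · rw [cost_add]
    exact le_self_add
  · rw [traj_skipBlock_add f x a hloop, Nat.add_right_comm i d k]
    simp [skipBlock]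

/-- A trajectory of at least `|X|` steps revisits a state. -/
theorem exists_traj_loop [Fintype X] (f : X → U → X) (x : X) (a : ℕ → U) {K : ℕ}
    (hK : Fintype.card X ≤ K) :
    ∃ i d, 0 < d ∧ i + d ≤ K ∧ traj f x a (i + d) = traj f x a i := by
  obtain ⟨p, q, hpq, heq⟩ := Fintype.exists_ne_map_eq_of_card_lt
    (fun k : Fin (K + 1) => traj f x a k) (by simpa using Nat.lt_succ_of_le hK)
  wlog hlt : p < q generalizing p q
  · exact this q p hpq.symm heq.symm (lt_of_le_of_ne (not_lt.1 hlt) hpq.symm)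
  have hlt' : (p : ℕ) < q := hlt
  refine ⟨p, q - p, by omega, by omega, ?_⟩
  rw [Nat.add_sub_cancel' hlt'.le]
  exact heq.symm

/-- Loop removal: any goal-reaching action sequence can be replaced by one reaching
the goal in fewer than `|X|` steps at no greater cost. -/
theorem loop_removal [Fintype X] [Fintype U] [Nonempty U]
    (f : X → U → X) (ℓ : X → U → ℝ≥0) (G : Set X)
    (x : X) (K : ℕ) (a : ℕ → U) (h : traj f x a K ∈ G) :
    ∃ K' < Fintype.card X, ∃ a' : ℕ → U,
      traj f x a' K' ∈ G ∧ cost f ℓ x a' K' ≤ cost f ℓ x a K := by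
  induction K using Nat.strong_induction_on generalizing a with
  | _ K ih =>
    rcases lt_or_ge K (Fintype.card X) with hK | hK
    · exact ⟨K, hK, a, h, le_rfl⟩
    obtain ⟨i, d, hd, hle, hloop⟩ := exists_traj_loop f x a hK
    obtain ⟨m, rfl⟩ := Nat.exists_eq_add_of_le hle
    obtain ⟨K', hK', a', hgoal, hcost⟩ := ih (i + m) (by omega) (skipBlock a i d)
      (by rwa [traj_skipBlock_add f x a hloop, Nat.add_right_comm])
    exact ⟨K', hK', a', hgoal, hcost.trans (cost_skipBlock_le f ℓ x a hloop m)⟩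
end

section
/- Consider the deterministic planning problem with state space Fin 6, action type Bool, absorbing goal state 5, transition function f : Fin 6 → Bool → Fin 6 given by f x b = 5 if x = 5, f x true = x + 1 (as elements of Fin 6, for x ≤ 4), and f x false = x - 1 if x ≠ 0 and f 0 false = 0, and state cost ℓ : Fin 6 → ℝ given by ℓ x = 0 if x = 5 and ℓ x = (x : ℕ) + 1 otherwise. For a policy π : Fin 6 → Bool let g_π x = f x (π x) and define the total discounted cost from state 0 by L_α π = ∑' (k : ℕ), α^k * ℓ (g_π^[k] 0). Then there exists α ∈ Set.Ioo (0 : ℝ) 1 such that every policy π minimizing L_α (i.e. satisfying L_α π ≤ L_α π' for all policies π') never reaches the goal: g_π^[K] 0 ≠ 5 for all K : ℕ. -/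
/-- Transition function of the line-graph example: the goal state `5` is absorbing,
action `true` moves one step up and action `false` one step down (clamped at `0`). -/
def lineStep : Fin 6 → Bool → Fin 6 := fun x b =>
  if x = 5 then 5
  else if b then x + 1
  else if x = 0 then 0 else x - 1

/-- State cost of the line-graph example: `0` at the goal state `5` and `x + 1`
at every other state `x`. -/
noncomputable def lineCost : Fin 6 → ℝ := fun x =>
  if x = 5 then 0 else (x : ℕ) + 1

theorem lineCost_nonneg (x : Fin 6) : 0 ≤ lineCost x := by
  unfold lineCost
  split_ifs <;> positivity

theorem lineCost_le (x : Fin 6) : lineCost x ≤ 6 := by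
  unfold lineCost
  split_ifs
  · norm_num
  · have h : ((x : ℕ) : ℝ) ≤ 5 := by exact_mod_cast Nat.le_of_lt_succ x.isLt
    linarith

theorem summable_discounted_lineCost {α : ℝ} (h0 : 0 ≤ α) (h1 : α < 1) (u : ℕ → Fin 6) :
    Summable fun k => α ^ k * lineCost (u k) :=
  Summable.of_nonneg_of_le (fun k => mul_nonneg (pow_nonneg h0 k) (lineCost_nonneg _))
    (fun k => mul_le_mul_of_nonneg_left (lineCost_le _) (pow_nonneg h0 k))
    ((summable_geometric_of_lt_one h0 h1).mul_right 6)

/-- A policy that moves down at `0` stays at `0` forever. -/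
theorem iterate_lineStep_zero {π : Fin 6 → Bool} (h : π 0 = false) (k : ℕ) :
    (fun x => lineStep x (π x))^[k] 0 = 0 :=
  Function.iterate_fixed (by simp [lineStep, h]) k

/-- The dangers of discounting (Proposition 3, instantiated on the paper's example):
for a suitable discount factor `α ∈ (0,1)`, every policy minimizing the total
discounted cost from state `0` never reaches the goal state `5`. -/
theorem discounting_misses_goal :
    ∃ α ∈ Set.Ioo (0 : ℝ) 1,
      ∀ π : Fin 6 → Bool,
        (∀ π' : Fin 6 → Bool,
            (∑' k : ℕ, α ^ k * lineCost ((fun x => lineStep x (π x))^[k] 0)) ≤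
            (∑' k : ℕ, α ^ k * lineCost ((fun x => lineStep x (π' x))^[k] 0))) →
        ∀ K : ℕ, (fun x => lineStep x (π x))^[K] 0 ≠ 5 := by
  refine ⟨1 / 4, by norm_num, fun π hπ K => ?_⟩
  cases h : π 0 with
  | false =>
    rw [iterate_lineStep_zero h]
    decide
  | true =>
    exfalso
    have stay : ∑' k : ℕ, (1 / 4 : ℝ) ^ k *
        lineCost ((fun x => lineStep x ((fun _ => false : Fin 6 → Bool) x))^[k] 0) = 4 / 3 := by
      have hc : lineCost 0 = 1 := by simp [lineCost]
      simp_rw [iterate_lineStep_zero (π := fun _ => false) rfl, hc, mul_one]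
      rw [tsum_geometric_of_lt_one (by norm_num) (by norm_num)]
      norm_num
    have move := (summable_discounted_lineCost (α := 1 / 4) (by norm_num) (by norm_num)
      (fun k => (fun x => lineStep x (π x))^[k] 0)).sum_le_tsum (Finset.range 2)
      (fun k _ => mul_nonneg (by positivity) (lineCost_nonneg _))
    have first_two : ∑ k ∈ Finset.range 2, (1 / 4 : ℝ) ^ k *
        lineCost ((fun x => lineStep x (π x))^[k] 0) = 3 / 2 := by
      have hs : lineStep 0 true = 1 := by decide
      have h5 : (1 : Fin 6) ≠ 5 := by decide
      simp [Finset.sum_range_succ, h, hs, lineCost, h5]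
      norm_num
    have := hπ fun _ => false
    linarith
end

section
/- Let S*, L* : ℝ with 0 < S*, let M : ℝ, and let 𝒰 be a finite set of pairs (S, L) : ℝ × ℝ such that 0 < S for every (S, L) ∈ 𝒰, and such that every (S, L) ∈ 𝒰 with S = S* satisfies L* ≤ L. Then the following are equivalent: (i) for every (S, L) ∈ 𝒰, (L* + M) / S* ≤ (L + M) / S; (ii) for every (S, L) ∈ 𝒰 with S < S*, (S* * L - S * L*) / (S - S*) ≤ M, and for every (S, L) ∈ 𝒰 with S* < S, M ≤ (S* * L - S * L*) / (S - S*). -/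
/-- Proposition 4 (episodic equivalence), in cross-multiplied threshold form: the
sequence with data `(S*, L*)` attains the smallest asymptotic average cost
`(L + M)/S` among a finite collection `𝒰` of goal-reaching sequences if and only if
the reset bonus `M` lies above the threshold `(S*·L − S·L*)/(S − S*)` for every
strictly shorter competitor and below it for every strictly longer competitor. -/
theorem episodic_equivalence (Sstar Lstar : ℝ) (hSstar : 0 < Sstar) (M : ℝ)
    (𝒰 : Finset (ℝ × ℝ))
    (hpos : ∀ p ∈ 𝒰, 0 < p.1)
    (hmin : ∀ p ∈ 𝒰, p.1 = Sstar → Lstar ≤ p.2) :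
    (∀ p ∈ 𝒰, (Lstar + M) / Sstar ≤ (p.2 + M) / p.1) ↔
      ((∀ p ∈ 𝒰, p.1 < Sstar → (Sstar * p.2 - p.1 * Lstar) / (p.1 - Sstar) ≤ M) ∧
       (∀ p ∈ 𝒰, Sstar < p.1 → M ≤ (Sstar * p.2 - p.1 * Lstar) / (p.1 - Sstar))) := by
  constructor
  · intro h
    refine ⟨fun p hp hlt => ?_, fun p hp hlt => ?_⟩
    · have hle := (div_le_div_iff₀ hSstar (hpos p hp)).1 (h p hp)
      rw [div_le_iff_of_neg (sub_neg.2 hlt)]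
      linarith
    · have hle := (div_le_div_iff₀ hSstar (hpos p hp)).1 (h p hp)
      rw [le_div_iff₀ (sub_pos.2 hlt)]
      linarith
  · rintro ⟨hshort, hlong⟩ p hp
    rcases lt_trichotomy p.1 Sstar with hlt | heq | hlt
    · have hle := (div_le_iff_of_neg (sub_neg.2 hlt)).1 (hshort p hp hlt)
      rw [div_le_div_iff₀ hSstar (hpos p hp)]
      linarith
    · have hle := hmin p hp heq
      rw [heq]
      gcongr
    · have hle := (le_div_iff₀ (sub_pos.2 hlt)).1 (hlong p hp hlt)
      rw [div_le_div_iff₀ hSstar (hpos p hp)]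
      linarith
end
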